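/- Cut alignment lemma (deterministic core of Lemma 5.2): Let (V, w) be a weighted graph, R ⊆ V, and {Ŝ_v}_{v ∈ R} pairwise disjoint subsets of V with Ŝ_v ∩ R = {v} for each v ∈ R. For v ∈ R let μ_v = min{w(X) : X ⊆ V, X ∩ R = {v}}, and suppose Σ_{v ∈ R} (w(Ŝ_v) − μ_v) ≤ Δ for a real Δ. Let p, q ∈ V be distinct vertices not contained in ⋃_{v ∈ R} Ŝ_v, and let S ⊆ V with p ∈ S and q ∉ S. Then the set S* = (S ∪ ⋃_{v ∈ R ∩ S} Ŝ_v) ∖ ⋃_{v ∈ R ∖ S} Ŝ_v satisfies p ∈ S*, q ∉ S*, each Ŝ_v is either contained in S* or disjoint from S*, and w(S*) ≤ w(S) + 2Δ. -/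

import Mathlib

open Finset

/-- Cut value of a set `S` in a weighted graph on a finite vertex type `V`. -/
def cutVal {V : Type*} [Fintype V] [DecidableEq V] (w : V → V → ℝ) (S : Finset V) : ℝ :=
  ∑ u ∈ S, ∑ v ∈ Sᶜ, w u v

/-- Minimum isolating cut value of a terminal `v ∈ R`. -/
noncomputable def minIsoCutVal {V : Type*} [Fintype V] [DecidableEq V]
    (w : V → V → ℝ) (R : Finset V) (v : V) : ℝ :=
  sInf {x : ℝ | ∃ S : Finset V, S ∩ R = {v} ∧ cutVal w S = x}

section

variable {V : Type*} [Fintype V] [DecidableEq V] {w : V → V → ℝ}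

theorem cutVal_eq_sum_ite (w : V → V → ℝ) (S : Finset V) :
    cutVal w S = ∑ u, ∑ v, if u ∈ S ∧ v ∉ S then w u v else 0 := by
  simp [cutVal, ite_and, Finset.compl_eq_univ_sdiff, Finset.sdiff_eq_filter,
    Finset.sum_filter]

theorem cutVal_nonneg (hnonneg : ∀ u v, 0 ≤ w u v) (S : Finset V) : 0 ≤ cutVal w S :=
  Finset.sum_nonneg fun u _ => Finset.sum_nonneg fun v _ => hnonneg u v

theorem cutVal_compl (hsymm : ∀ u v, w u v = w v u) (S : Finset V) :
    cutVal w Sᶜ = cutVal w S := by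
  unfold cutVal
  rw [compl_compl, Finset.sum_comm]
  simp only [hsymm]

theorem cutVal_union_add_inter_le (hnonneg : ∀ u v, 0 ≤ w u v) (A B : Finset V) :
    cutVal w (A ∪ B) + cutVal w (A ∩ B) ≤ cutVal w A + cutVal w B := by
  simp only [cutVal_eq_sum_ite, ← Finset.sum_add_distrib]
  refine Finset.sum_le_sum fun u _ => Finset.sum_le_sum fun v _ => ?_
  have := hnonneg u v
  by_cases hA : u ∈ A <;> by_cases hB : u ∈ B <;> by_cases hA' : v ∈ A <;>
    by_cases hB' : v ∈ B <;> simp [hA, hB, hA', hB', this]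

theorem cutVal_sdiff_add_sdiff_le (hsymm : ∀ u v, w u v = w v u)
    (hnonneg : ∀ u v, 0 ≤ w u v) (A B : Finset V) :
    cutVal w (A \ B) + cutVal w (B \ A) ≤ cutVal w A + cutVal w B := by
  have h := cutVal_union_add_inter_le hnonneg Aᶜ B
  have h₁ : Aᶜ ∪ B = (A \ B)ᶜ := by ext; simp; tauto
  have h₂ : Aᶜ ∩ B = B \ A := by ext; simp; tauto
  rwa [h₁, h₂, cutVal_compl hsymm, cutVal_compl hsymm] at h

theorem minIsoCutVal_le_of_subset (hnonneg : ∀ u v, 0 ≤ w u v) {R X Y : Finset V} {v : V}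
    (hY : Y ∩ R = {v}) (hXY : X ⊆ Y) (hv : v ∈ X) : minIsoCutVal w R v ≤ cutVal w X := by
  refine csInf_le ⟨0, ?_⟩ ⟨X, ?_, rfl⟩
  · rintro _ ⟨S, -, rfl⟩
    exact cutVal_nonneg hnonneg S
  · have hvR : v ∈ Y ∩ R := by simp [hY]
    exact (Finset.Nonempty.subset_singleton_iff
      ⟨v, Finset.mem_inter.2 ⟨hv, (Finset.mem_inter.1 hvR).2⟩⟩).1
      (hY ▸ Finset.inter_subset_inter_right hXY)

/-- Aligning `S` with the sets `Shat v`, `v ∈ T`, costs at most their total excess. -/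
theorem cutVal_align_le (hsymm : ∀ u v, w u v = w v u) (hnonneg : ∀ u v, 0 ≤ w u v)
    {R : Finset V} {Shat : V → Finset V}
    (hdisj : ∀ v ∈ R, ∀ u ∈ R, v ≠ u → Disjoint (Shat v) (Shat u))
    (hiso : ∀ v ∈ R, (Shat v) ∩ R = {v}) (S : Finset V) {T : Finset V} (hT : T ⊆ R) :
    cutVal w ((S ∪ (T ∩ S).biUnion Shat) \ (T \ S).biUnion Shat) ≤
      cutVal w S + ∑ v ∈ T, (cutVal w (Shat v) - minIsoCutVal w R v) := by
  induction T using Finset.induction_on with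
  | empty => simp
  | insert v T hvT ih =>
    obtain ⟨hvR, hTR⟩ := Finset.insert_subset_iff.1 hT
    have ih := ih hTR
    rw [Finset.sum_insert hvT]
    have hdisj' : ∀ x ∈ Shat v, ∀ u ∈ T, x ∉ Shat u := fun x hx u hu hxu =>
      Finset.disjoint_left.1
        (hdisj v hvR u (hTR hu) (ne_of_mem_of_not_mem hu hvT).symm) hx hxu
    have hvv : v ∈ Shat v :=
      (Finset.mem_inter.1 (hiso v hvR ▸ Finset.mem_singleton_self v)).1
    set A := (S ∪ (T ∩ S).biUnion Shat) \ (T \ S).biUnion Shat with hA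
    by_cases hvS : v ∈ S
    · have hins : (S ∪ (insert v T ∩ S).biUnion Shat) \ (insert v T \ S).biUnion Shat =
          A ∪ Shat v := by
        rw [Finset.insert_inter_of_mem hvS, Finset.insert_sdiff_of_mem _ hvS,
          Finset.biUnion_insert]
        ext x
        have := hdisj' x
        simp only [hA, Finset.mem_sdiff, Finset.mem_union, Finset.mem_biUnion]
        grind
      have hvA : v ∈ A := by
        have := hdisj' v hvv
        simp only [hA, Finset.mem_sdiff, Finset.mem_union, Finset.mem_biUnion]
        grind
      have h₁ := cutVal_union_add_inter_le hnonneg A (Shat v)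
      have h₂ := minIsoCutVal_le_of_subset hnonneg (hiso v hvR)
        (Finset.inter_subset_right (s₁ := A)) (Finset.mem_inter.2 ⟨hvA, hvv⟩)
      rw [hins]
      linarith
    · have hins : (S ∪ (insert v T ∩ S).biUnion Shat) \ (insert v T \ S).biUnion Shat =
          A \ Shat v := by
        rw [Finset.insert_inter_of_notMem hvS, Finset.insert_sdiff_of_notMem _ hvS,
          Finset.biUnion_insert]
        ext x
        simp only [hA, Finset.mem_sdiff, Finset.mem_union]
        tauto
      have hvA : v ∉ A := by
        have := hdisj' v hvv
        simp only [hA, Finset.mem_sdiff, Finset.mem_union, Finset.mem_biUnion]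
        grind
      have h₁ := cutVal_sdiff_add_sdiff_le hsymm hnonneg A (Shat v)
      have h₂ := minIsoCutVal_le_of_subset hnonneg (hiso v hvR)
        (Finset.sdiff_subset (t := A)) (Finset.mem_sdiff.2 ⟨hvv, hvA⟩)
      rw [hins]
      linarith

end

/-- Cut alignment lemma: given pairwise disjoint approximate minimum isolating
cuts `Ŝ_v` with total excess at most `Δ`, any `(p,q)`-cut `S` can be aligned with
the sets `Ŝ_v` at an additive cost of at most `2Δ`. -/
theorem cut_alignment {V : Type*} [Fintype V] [DecidableEq V] (w : V → V → ℝ)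
    (hsymm : ∀ u v, w u v = w v u) (hnonneg : ∀ u v, 0 ≤ w u v)
    (hdiag : ∀ u, w u u = 0)
    (R : Finset V) (Shat : V → Finset V)
    (hdisj : ∀ v ∈ R, ∀ u ∈ R, v ≠ u → Disjoint (Shat v) (Shat u))
    (hiso : ∀ v ∈ R, (Shat v) ∩ R = {v})
    (Δ : ℝ) (hΔ : ∑ v ∈ R, (cutVal w (Shat v) - minIsoCutVal w R v) ≤ Δ)
    (p q : V) (hpq : p ≠ q)
    (hp : p ∉ R.biUnion Shat) (hq : q ∉ R.biUnion Shat)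
    (S : Finset V) (hpS : p ∈ S) (hqS : q ∉ S) :
    p ∈ (S ∪ (R ∩ S).biUnion Shat) \ (R \ S).biUnion Shat ∧
    q ∉ (S ∪ (R ∩ S).biUnion Shat) \ (R \ S).biUnion Shat ∧
    (∀ v ∈ R, Shat v ⊆ (S ∪ (R ∩ S).biUnion Shat) \ (R \ S).biUnion Shat ∨
      Disjoint (Shat v) ((S ∪ (R ∩ S).biUnion Shat) \ (R \ S).biUnion Shat)) ∧
    cutVal w ((S ∪ (R ∩ S).biUnion Shat) \ (R \ S).biUnion Shat) ≤
      cutVal w S + 2 * Δ := by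
  refine ⟨?_, ?_, fun v hv => ?_, ?_⟩
  · simp only [Finset.mem_sdiff, Finset.mem_union, Finset.mem_biUnion] at hp ⊢
    grind
  · simp only [Finset.mem_sdiff, Finset.mem_union, Finset.mem_biUnion] at hq ⊢
    grind
  · by_cases hvS : v ∈ S
    · left
      intro x hx
      have hx' : ∀ u ∈ R, v ≠ u → x ∉ Shat u := fun u hu hne =>
        Finset.disjoint_left.1 (hdisj v hv u hu hne) hx
      simp only [Finset.mem_sdiff, Finset.mem_union, Finset.mem_biUnion]
      grind
    · right
      exact Finset.disjoint_sdiff.mono_left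
        (Finset.subset_biUnion_of_mem Shat (Finset.mem_sdiff.2 ⟨hv, hvS⟩))
  · have hexcess : 0 ≤ ∑ v ∈ R, (cutVal w (Shat v) - minIsoCutVal w R v) :=
      Finset.sum_nonneg fun v hv => sub_nonneg.2 <|
        minIsoCutVal_le_of_subset hnonneg (hiso v hv) Finset.Subset.rfl
          (Finset.mem_inter.1 (hiso v hv ▸ Finset.mem_singleton_self v)).1
    have := cutVal_align_le hsymm hnonneg hdisj hiso S (Finset.Subset.refl R)
    linarith
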